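/- Let m ≥ 1, let Q be an m×m real matrix, let h_u ∈ ℝ^m, and let h_{v_1}, …, h_{v_k} ∈ ℝ^m. Suppose h_v = ∑_{i=1}^k a_i h_{v_i} with a_i ≥ 0 and ∑_{i=1}^k a_i = 1. Fix θ > 0, and for vectors x, y ∈ ℝ^m let f_{xy} be distributed according to the Gamma distribution with shape θ and scale λ_{xy} = exp(xᵀQy) (so its mean is θλ_{xy}). Then min_{1≤i≤k} E[f_{u v_i}] ≤ E[f_{u v}] ≤ ∑_{i=1}^k a_i E[f_{u v_i}], and likewise min_{1≤i≤k} E[f_{v_i u}] ≤ E[f_{v u}] ≤ ∑_{i=1}^k a_i E[f_{v_i u}]. -/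

import Mathlib

open Matrix

open MeasureTheory ProbabilityTheory

/-- The mean of the Gamma distribution with shape `a` and rate `r` is `a / r`. -/
theorem integral_id_gammaMeasure {a r : ℝ} (ha : 0 < a) (hr : 0 < r) :
    ∫ x, x ∂(gammaMeasure a r) = a / r := by
  have hpdf : Measurable (gammaPDF a r) := (measurable_gammaPDFReal a r).ennreal_ofReal
  rw [gammaMeasure, integral_withDensity_eq_integral_toReal_smul hpdf
    (Filter.Eventually.of_forall fun x => ENNReal.ofReal_lt_top)]
  have hindicator : (fun x : ℝ => (gammaPDF a r x).toReal • x) =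
      (Set.Ioi (0 : ℝ)).indicator
        (fun x => r ^ a / Real.Gamma a * (x ^ (a + 1 - 1) * Real.exp (-(r * x)))) := by
    ext x
    rw [gammaPDF, ENNReal.toReal_ofReal (gammaPDFReal_nonneg ha hr x), smul_eq_mul]
    rcases lt_trichotomy x 0 with hx | rfl | hx
    · simp [gammaPDFReal, hx.not_ge, hx.le]
    · simp
    · rw [Set.indicator_of_mem (Set.mem_Ioi.mpr hx), gammaPDFReal, if_pos hx.le,
        add_sub_right_comm, Real.rpow_add_one hx.ne']
      ring
  rw [hindicator, integral_indicator measurableSet_Ioi, integral_const_mul,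
    Real.integral_rpow_mul_exp_neg_mul_Ioi (by linarith) hr, Real.Gamma_add_one ha.ne',
    Real.div_rpow zero_le_one hr.le, Real.one_rpow, Real.rpow_add_one hr.ne']
  have := (Real.Gamma_pos_of_pos ha).ne'
  have := (Real.rpow_pos_of_pos hr a).ne'
  field_simp

/-- A monotone convex function at a convex combination lies between the minimum and the
convex combination of its values. -/
theorem inf'_le_and_le_sum_of_convexOn {ι : Type*} {s : Finset ι} (hs : s.Nonempty)
    {g : ℝ → ℝ} (hmono : Monotone g) (hg : ConvexOn ℝ Set.univ g) {a t : ι → ℝ}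
    (ha : ∀ i ∈ s, 0 ≤ a i) (hasum : ∑ i ∈ s, a i = 1) :
    s.inf' hs (fun i => g (t i)) ≤ g (∑ i ∈ s, a i * t i) ∧
      g (∑ i ∈ s, a i * t i) ≤ ∑ i ∈ s, a i * g (t i) := by
  constructor
  · obtain ⟨i, hi, hmin⟩ := s.exists_min_image t hs
    refine (Finset.inf'_le _ hi).trans (hmono ?_)
    calc t i = ∑ j ∈ s, a j * t i := by rw [← Finset.sum_mul, hasum, one_mul]
      _ ≤ ∑ j ∈ s, a j * t j :=
        Finset.sum_le_sum fun j hj => mul_le_mul_of_nonneg_left (hmin j hj) (ha j hj)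
  · simpa only [smul_eq_mul] using hg.map_sum_le ha hasum fun i _ => Set.mem_univ (t i)

/-- For Gamma-distributed frequencies with shape `θ` and scale
`λ_{xy} = exp(xᵀQy)`, if `h_v` is a convex combination of `h_{v_1}, …, h_{v_k}`,
then the expected frequency `E[f_{uv}]` lies between the minimum and the convex
combination of the `E[f_{u v_i}]`, and likewise with the roles of the two
arguments reversed. Expectations are integrals of the identity against the
Gamma measure with shape `θ` and rate `1/λ`. -/
theorem stmt0 (m k : ℕ) (hm : 1 ≤ m) (hk : 0 < k)
    (Q : Matrix (Fin m) (Fin m) ℝ)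
    (hu hv : Fin m → ℝ) (hvs : Fin k → (Fin m → ℝ)) (a : Fin k → ℝ)
    (ha : ∀ i, 0 ≤ a i) (hasum : ∑ i, a i = 1)
    (hconv : hv = ∑ i, a i • hvs i)
    (θ : ℝ) (hθ : 0 < θ)
    (E : (Fin m → ℝ) → (Fin m → ℝ) → ℝ)
    (hE : ∀ x y, E x y =
      ∫ f, f ∂ (gammaMeasure θ (Real.exp (x ⬝ᵥ Q.mulVec y))⁻¹)) :
    (Finset.univ.inf' ⟨⟨0, hk⟩, Finset.mem_univ _⟩ (fun i => E hu (hvs i))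
        ≤ E hu hv ∧ E hu hv ≤ ∑ i, a i * E hu (hvs i)) ∧
    (Finset.univ.inf' ⟨⟨0, hk⟩, Finset.mem_univ _⟩ (fun i => E (hvs i) hu)
        ≤ E hv hu ∧ E hv hu ≤ ∑ i, a i * E (hvs i) hu) := by
  have hmean : ∀ x y, E x y = θ * Real.exp (x ⬝ᵥ Q.mulVec y) := fun x y => by
    rw [hE, integral_id_gammaMeasure hθ (inv_pos.mpr (Real.exp_pos _)), div_inv_eq_mul]
  have hright : hu ⬝ᵥ Q.mulVec hv = ∑ i, a i * (hu ⬝ᵥ Q.mulVec (hvs i)) := by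
    simp only [hconv, Matrix.mulVec_sum, Matrix.mulVec_smul, dotProduct_sum, dotProduct_smul,
      smul_eq_mul]
  have hleft : hv ⬝ᵥ Q.mulVec hu = ∑ i, a i * (hvs i ⬝ᵥ Q.mulVec hu) := by
    simp only [hconv, sum_dotProduct, smul_dotProduct, smul_eq_mul]
  have hmono : Monotone fun t => θ * Real.exp t := Real.exp_monotone.const_mul hθ.le
  have hcvx : ConvexOn ℝ Set.univ fun t => θ * Real.exp t := convexOn_exp.smul hθ.le
  simp only [hmean, hright, hleft]
  exact ⟨inf'_le_and_le_sum_of_convexOn _ hmono hcvx (fun i _ => ha i) hasum,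
    inf'_le_and_le_sum_of_convexOn _ hmono hcvx (fun i _ => ha i) hasum⟩
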